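/- For every natural number k, the limit μ_k := lim_{x→∞} (1/x)·∑_{N ≤ x} K*(N)^k exists, and equals the convergent Euler product μ_k = ∏_ℓ (P_A(ℓ) + P_B(ℓ) + P_C(ℓ)), where P_A(ℓ) = (1 − 2/ℓ)^{k+1}(1 − 1/ℓ)^{−2k}, P_B(ℓ) = (1 − 1/ℓ)^{1−k} ∑_{d=1}^∞ ℓ^{−d}(1 − 1/(ℓ^d(ℓ−1)))^k, and P_C(ℓ) = (1/ℓ)(1 − 1/((ℓ−1)²(ℓ+1)))^k. -/

import Mathlib

/-- The Euler factor at `p` of the function `K(N)` from Definition 1. Here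
`((N-1)/p)² = 1` if `p ∤ N - 1` and `0` if `p ∣ N - 1`. -/
noncomputable def Kfactor (N : ℕ) (p : ℕ) : ℝ :=
  if p ∣ N then
    1 - 1/((p:ℝ)^(N.factorization p) * ((p:ℝ) - 1))
  else
    1 - ((if (p:ℤ) ∣ ((N:ℤ) - 1) then (0:ℝ) else 1) * (p:ℝ) + 1)
          / (((p:ℝ) - 1)^2 * ((p:ℝ) + 1))

/-- The function `K(N)` of Definition 1, as a product over all primes. -/
noncomputable def K (N : ℕ) : ℝ := ∏' p : Nat.Primes, Kfactor N (p : ℕ)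

/-- The function `K*(N) = K(N)·N/φ(N)`. -/
noncomputable def Kstar (N : ℕ) : ℝ := K N * (N:ℝ) / (Nat.totient N : ℝ)

/-- `P_A(ℓ) = (1 - 2/ℓ)^{k+1} (1 - 1/ℓ)^{-2k}`. -/
noncomputable def PA (k : ℕ) (ℓ : ℕ) : ℝ :=
  (1 - 2/(ℓ:ℝ))^(k+1) * (1 - 1/(ℓ:ℝ)) ^ (-(2 * (k:ℤ)))

/-- `P_B(ℓ) = (1 - 1/ℓ)^{1-k} ∑_{d ≥ 1} ℓ^{-d} (1 - 1/(ℓ^d(ℓ-1)))^k`. -/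
noncomputable def PB (k : ℕ) (ℓ : ℕ) : ℝ :=
  (1 - 1/(ℓ:ℝ)) ^ ((1:ℤ) - (k:ℤ)) *
    ∑' d : ℕ, (1/(ℓ:ℝ)^(d+1)) * (1 - 1/((ℓ:ℝ)^(d+1) * ((ℓ:ℝ) - 1)))^k

/-- `P_C(ℓ) = (1/ℓ)(1 - 1/((ℓ-1)²(ℓ+1)))^k`. -/
noncomputable def PC (k : ℕ) (ℓ : ℕ) : ℝ :=
  (1/(ℓ:ℝ)) * (1 - 1/(((ℓ:ℝ) - 1)^2 * ((ℓ:ℝ) + 1)))^k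

lemma aux_upper (u v : Nat.Primes → ℝ) (hu : ∀ p, 0 ≤ u p) (hv : ∀ p, 0 ≤ v p) (n : ℕ)
    (S : Finset Nat.Primes) : ∀ m : ℕ, 0 < m → (∀ p ∈ S, Nat.Coprime (p : ℕ) m) →
    ∑ N ∈ Finset.Ioc 0 n, (if m ∣ N then
      ∏ p ∈ S, (u p * (if (p : ℕ) ∣ N then 1 else 0) + v p) else 0)
      ≤ (n : ℝ) / m * ∏ p ∈ S, (u p / (p : ℕ) + v p) := by
  induction S using Finset.induction_on with
  | empty =>
    intro m hm _
    have h1 := Nat.Ioc_filter_dvd_card_eq_div n m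
    simp only [Finset.prod_empty, mul_one]
    rw [← Finset.sum_filter, Finset.sum_const, h1, nsmul_eq_mul, mul_one]
    exact Nat.cast_div_le
  | insert p S hp ih =>
    intro m hm hc
    have hcS : ∀ q ∈ S, Nat.Coprime (q : ℕ) m := fun q hq => hc q (Finset.mem_insert_of_mem hq)
    have hcp : Nat.Coprime (p : ℕ) m := hc p (Finset.mem_insert_self _ _)
    have i1 := ih m hm hcS
    have i2 := ih (p * m) (Nat.mul_pos p.2.pos hm) (by
      intro q hq
      refine Nat.Coprime.mul_right ?_ (hcS q hq)
      rw [Nat.coprime_primes q.2 p.2]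
      intro h
      have : q = p := Subtype.ext h
      exact hp (this ▸ hq))
    have e1 : ∑ N ∈ Finset.Ioc 0 n, (if m ∣ N then
        ∏ p ∈ insert p S, (u p * (if (p : ℕ) ∣ N then 1 else 0) + v p) else 0)
        = u p * ∑ N ∈ Finset.Ioc 0 n, (if (p : ℕ) * m ∣ N then
        ∏ p ∈ S, (u p * (if (p : ℕ) ∣ N then 1 else 0) + v p) else 0)
        + v p * ∑ N ∈ Finset.Ioc 0 n, (if m ∣ N then
        ∏ p ∈ S, (u p * (if (p : ℕ) ∣ N then 1 else 0) + v p) else 0) := by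
      rw [Finset.mul_sum, Finset.mul_sum, ← Finset.sum_add_distrib]
      refine Finset.sum_congr rfl fun N _ => ?_
      rw [Finset.prod_insert hp]
      have : (p : ℕ) * m ∣ N ↔ (p : ℕ) ∣ N ∧ m ∣ N := 
        ⟨fun h => ⟨dvd_of_mul_right_dvd h, dvd_of_mul_left_dvd h⟩,
          fun h => hcp.mul_dvd_of_dvd_of_dvd h.1 h.2⟩
      by_cases h1 : m ∣ N <;> by_cases h2 : (p : ℕ) ∣ N <;> simp [this, h1, h2]
      ring
    rw [e1, Finset.prod_insert hp]
    calc _ ≤ u p * ((n : ℝ) / ((p * m : ℕ) : ℝ) * ∏ p ∈ S, (u p / (p : ℕ) + v p))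
          + v p * ((n : ℝ) / m * ∏ p ∈ S, (u p / (p : ℕ) + v p)) :=
          add_le_add (mul_le_mul_of_nonneg_left i2 (hu p)) (mul_le_mul_of_nonneg_left i1 (hv p))
      _ = _ := by
        have : ((p : ℕ) : ℝ) ≠ 0 := by exact_mod_cast p.2.ne_zero
        have : (m : ℝ) ≠ 0 := by exact_mod_cast hm.ne'
        push_cast
        field_simp

lemma aux_count (q r : ℕ) (hq : 0 < q) :
    Filter.Tendsto (fun n : ℕ => (1 / (n : ℝ)) * ∑ N ∈ Finset.Ioc 0 n,
      (if N ≡ r [MOD q] then (1 : ℝ) else 0)) Filter.atTop (nhds (1 / (q : ℝ))) := by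
  have hq' : (0 : ℝ) < q := by exact_mod_cast hq
  have key : ∀ n : ℕ, |∑ N ∈ Finset.Ioc 0 n, (if N ≡ r [MOD q] then (1 : ℝ) else 0) - n / q| ≤ 1 := by
    intro n
    have h := Nat.Ioc_filter_modEq_card 0 n hq r
    have hm : ⌊((0 : ℕ) - r : ℚ) / q⌋ ≤ ⌊((n : ℚ) - r) / q⌋ := by
      apply Int.floor_le_floor
      gcongr
      exact_mod_cast Nat.zero_le n
    rw [max_eq_left (by linarith)] at h
    rw [← Finset.sum_filter, Finset.sum_const, nsmul_eq_mul, mul_one]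
    have h' : ((Finset.card {x ∈ Finset.Ioc 0 n | x ≡ r [MOD q]} : ℕ) : ℚ)
      = (⌊((n : ℚ) - r) / q⌋ : ℚ) - ⌊((0 : ℕ) - r : ℚ) / q⌋ := by exact_mod_cast h
    have f1 := Int.floor_le (((n : ℚ) - r) / q)
    have f2 := Int.lt_floor_add_one (((n : ℚ) - r) / q)
    have f3 := Int.floor_le (((0 : ℕ) - r : ℚ) / q)
    have f4 := Int.lt_floor_add_one (((0 : ℕ) - r : ℚ) / q)
    have e : (n : ℚ) / q = ((n : ℚ) - r) / q - ((0 : ℕ) - r : ℚ) / q := by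
      push_cast; ring
    have : |((Finset.card {x ∈ Finset.Ioc 0 n | x ≡ r [MOD q]} : ℕ) : ℚ) - n / q| ≤ 1 := by
      rw [h', e, abs_le]
      constructor <;> linarith
    have h2 := (Rat.cast_le (K := ℝ)).2 this
    push_cast at h2
    exact h2
  have h0 : Filter.Tendsto (fun n : ℕ => (1 / (n : ℝ))) Filter.atTop (nhds 0) :=
    tendsto_one_div_atTop_nhds_zero_nat
  rw [tendsto_iff_norm_sub_tendsto_zero]
  refine squeeze_zero' (Filter.Eventually.of_forall fun n => norm_nonneg _) ?_ h0
  filter_upwards [Filter.eventually_gt_atTop 0] with n hn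
  have hn' : (0 : ℝ) < n := by exact_mod_cast hn
  have : (1 / (n : ℝ)) * ∑ N ∈ Finset.Ioc 0 n, (if N ≡ r [MOD q] then (1 : ℝ) else 0) - 1 / q
    = 1 / n * (∑ N ∈ Finset.Ioc 0 n, (if N ≡ r [MOD q] then (1 : ℝ) else 0) - n / q) := by
    field_simp
  rw [this, norm_mul, Real.norm_eq_abs, Real.norm_eq_abs, abs_of_pos (by positivity : 1 / (n : ℝ) > 0)]
  exact mul_le_of_le_one_right (by positivity) (key n)

lemma aux_bdd (a : Nat.Primes → ℕ → ℝ) (ha : ∀ p, ∃ C, ∀ N, 0 < N → |a p N| ≤ C)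
    (S : Finset Nat.Primes) : ∃ B, 0 ≤ B ∧ ∀ N, 0 < N → |∏ p ∈ S, a p N| ≤ B := by
  choose C hC using ha
  refine ⟨∏ p ∈ S, C p, ?_, ?_⟩
  · exact Finset.prod_nonneg fun p _ => (abs_nonneg _).trans (hC p 1 one_pos)
  · intro N hN
    rw [Finset.abs_prod]
    exact Finset.prod_le_prod (fun _ _ => abs_nonneg _) fun p _ => hC p N hN

lemma aux_mean (a : Nat.Primes → ℕ → ℝ) (α β e : Nat.Primes → ℝ) (γ : Nat.Primes → ℕ → ℝ)
    (hrep : ∀ p : Nat.Primes, ∀ N, 0 < N →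
      HasSum (fun d => γ p d * (if (p : ℕ) ^ (d + 1) ∣ N then 1 else 0))
        (a p N - α p - β p * (if N ≡ 1 [MOD p] then 1 else 0)))
    (hγ : ∀ p, ∃ C, ∀ d, |γ p d| ≤ C)
    (ha : ∀ p, ∃ C, ∀ N, 0 < N → |a p N| ≤ C)
    (he : ∀ p : Nat.Primes, e p = α p + β p / (p : ℕ) + ∑' d, γ p d / ((p : ℕ) : ℝ) ^ (d + 1))
    (S : Finset Nat.Primes) : ∀ q r : ℕ, 0 < q → (∀ p ∈ S, Nat.Coprime (p : ℕ) q) →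
    Filter.Tendsto (fun n : ℕ => (1 / (n : ℝ)) * ∑ N ∈ Finset.Ioc 0 n,
      (if N ≡ r [MOD q] then ∏ p ∈ S, a p N else 0)) Filter.atTop
      (nhds (1 / (q : ℝ) * ∏ p ∈ S, e p)) := by
  induction S using Finset.induction_on with
  | empty =>
    intro q r hq _
    simpa using aux_count q r hq
  | insert p S hp ih =>
    intro q r hq hc
    have hcS : ∀ t ∈ S, Nat.Coprime (t : ℕ) q := fun t ht => hc t (Finset.mem_insert_of_mem ht)
    have hcp : Nat.Coprime (p : ℕ) q := hc p (Finset.mem_insert_self _ _)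
    have hpp : (0 : ℝ) < (p : ℕ) := by exact_mod_cast p.2.pos
    have hp2 : (2 : ℝ) ≤ (p : ℕ) := by exact_mod_cast p.2.two_le
    have hcd : ∀ d, ∀ t ∈ S, Nat.Coprime (t : ℕ) (q * (p : ℕ) ^ d) := by
      intro d t ht
      refine Nat.Coprime.mul_right (hcS t ht) (Nat.Coprime.pow_right _ ?_)
      rw [Nat.coprime_primes t.2 p.2]
      intro h
      have : t = p := Subtype.ext h
      exact hp (this ▸ ht)
    have hcr : ∀ d s : ℕ, ∃ c : ℕ, ∀ N, N ≡ c [MOD q * (p : ℕ) ^ d] ↔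
        (N ≡ r [MOD q] ∧ N ≡ s [MOD (p : ℕ) ^ d]) := by
      intro d s
      have hco : Nat.Coprime q ((p : ℕ) ^ d) := (Nat.Coprime.pow_left d hcp).symm
      obtain ⟨c, hc1, hc2⟩ := Nat.chineseRemainder hco r s
      refine ⟨c, fun N => ?_⟩
      rw [← Nat.modEq_and_modEq_iff_modEq_mul hco]
      exact ⟨fun h => ⟨h.1.trans hc1, h.2.trans hc2⟩, fun h => ⟨h.1.trans hc1.symm, h.2.trans hc2.symm⟩⟩
    obtain ⟨B, hB0, hB⟩ := aux_bdd a ha S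
    obtain ⟨C, hC⟩ := hγ p
    have hC0 : 0 ≤ C := (abs_nonneg _).trans (hC 0)
    obtain ⟨c1, hc1⟩ := hcr 1 1
    choose c hcc using fun d => hcr (d + 1) 0
    have t0 := ih q r hq hcS
    have t1 := ih (q * (p : ℕ) ^ 1) c1 (Nat.mul_pos hq (pow_pos p.2.pos _)) (hcd 1)
    have t2 := fun d => ih (q * (p : ℕ) ^ (d + 1)) (c d) (Nat.mul_pos hq (pow_pos p.2.pos _)) (hcd (d + 1))
    set F : ℕ → ℕ → ℝ := fun d n => (1 / (n : ℝ)) * ∑ N ∈ Finset.Ioc 0 n,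
      (if N ≡ c d [MOD q * (p : ℕ) ^ (d + 1)] then ∏ p ∈ S, a p N else 0) with hF
    have hgeo : Summable fun d : ℕ => C * (B * (1 / ((p : ℕ) : ℝ)) ^ (d + 1)) := by
      refine Summable.mul_left _ (Summable.mul_left _ ?_)
      refine (summable_nat_add_iff 1).2 (summable_geometric_of_lt_one (by positivity) ?_)
      rw [div_lt_one hpp]; linarith
    have t3 : Filter.Tendsto (fun n : ℕ => ∑' d, γ p d * F d n) Filter.atTop
        (nhds (∑' d, γ p d * (1 / ((q * (p : ℕ) ^ (d + 1) : ℕ) : ℝ) * ∏ p ∈ S, e p))) := by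
      refine tendsto_tsum_of_dominated_convergence hgeo (fun d => (t2 d).const_mul _) ?_
      filter_upwards [Filter.eventually_gt_atTop 0] with n hn d
      have hn' : (0 : ℝ) < n := by exact_mod_cast hn
      rw [norm_mul, Real.norm_eq_abs, Real.norm_eq_abs]
      refine mul_le_mul (hC d) ?_ (abs_nonneg _) hC0
      rw [hF]
      simp only
      rw [abs_mul, abs_of_pos (by positivity : 1 / (n : ℝ) > 0)]
      have : |∑ N ∈ Finset.Ioc 0 n,
          (if N ≡ c d [MOD q * (p : ℕ) ^ (d + 1)] then ∏ p ∈ S, a p N else 0)|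
          ≤ ∑ N ∈ Finset.Ioc 0 n, (if (p : ℕ) ^ (d + 1) ∣ N then B else 0) := by
        refine (Finset.abs_sum_le_sum_abs _ _).trans (Finset.sum_le_sum fun N hN => ?_)
        have hN0 : 0 < N := (Finset.mem_Ioc.1 hN).1
        by_cases h : N ≡ c d [MOD q * (p : ℕ) ^ (d + 1)]
        · have h2 := ((hcc d N).1 h).2
          rw [Nat.modEq_zero_iff_dvd] at h2
          rw [if_pos h, if_pos h2]
          exact hB N hN0
        · rw [if_neg h, abs_zero]
          split_ifs <;> simp [hB0]
      have hB2 : ∑ N ∈ Finset.Ioc 0 n, (if (p : ℕ) ^ (d + 1) ∣ N then B else 0)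
          = ((n / (p : ℕ) ^ (d + 1) : ℕ) : ℝ) * B := by
        rw [← Finset.sum_filter, Finset.sum_const, Nat.Ioc_filter_dvd_card_eq_div, nsmul_eq_mul]
      rw [hB2] at this
      have h3 : ((n / (p : ℕ) ^ (d + 1) : ℕ) : ℝ) ≤ (n : ℝ) / ((p : ℕ) : ℝ) ^ (d + 1) := by
        refine Nat.cast_div_le.trans ?_
        push_cast; rfl
      calc _ ≤ 1 / (n : ℝ) * ((n : ℝ) / ((p : ℕ) : ℝ) ^ (d + 1) * B) := by
            gcongr
            exact this.trans (mul_le_mul_of_nonneg_right h3 hB0)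
        _ = _ := by
          rw [div_pow, one_pow]; field_simp
    have main := ((t0.const_mul (α p)).add (t1.const_mul (β p))).add t3
    refine (main.congr ?_).trans_eq ?_
    · intro n
      have hs : HasSum (fun d => γ p d * F d n) (1 / (n : ℝ) * ∑ N ∈ Finset.Ioc 0 n,
          ((a p N - α p - β p * (if N ≡ 1 [MOD p] then 1 else 0)) *
            (if N ≡ r [MOD q] then ∏ p ∈ S, a p N else 0))) := by
        have := (hasSum_sum (s := Finset.Ioc 0 n) fun N hN =>
          (hrep p N (Finset.mem_Ioc.1 hN).1).mul_right
            (if N ≡ r [MOD q] then ∏ p ∈ S, a p N else 0)).mul_left (1 / (n : ℝ))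
        refine Eq.mp (congrArg (fun f => HasSum f _) (funext fun d => ?_)) this
        symm
        rw [hF]
        simp only
        rw [mul_left_comm, Finset.mul_sum (a := γ p d)]
        congr 1
        refine Finset.sum_congr rfl fun N _ => ?_
        have h := hcc d N
        rw [Nat.modEq_zero_iff_dvd] at h
        by_cases h1 : N ≡ r [MOD q] <;> by_cases h2 : (p : ℕ) ^ (d + 1) ∣ N <;> simp [h, h1, h2]
      rw [hs.tsum_eq]
      rw [mul_left_comm (α p), mul_left_comm (β p), ← mul_add, ← mul_add, Finset.mul_sum,
        Finset.mul_sum (a := β p), ← Finset.sum_add_distrib, ← Finset.sum_add_distrib]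
      congr 1
      refine Finset.sum_congr rfl fun N _ => ?_
      have h := hc1 N
      rw [pow_one] at h ⊢
      rw [Finset.prod_insert hp]
      by_cases h1 : N ≡ r [MOD q] <;> by_cases h2 : N ≡ 1 [MOD p] <;> simp [h, h1, h2] <;> ring
    · congr 1
      rw [Finset.prod_insert hp, he p]
      have : ∀ d, γ p d * (1 / ((q * (p : ℕ) ^ (d + 1) : ℕ) : ℝ) * ∏ p ∈ S, e p)
          = (γ p d / ((p : ℕ) : ℝ) ^ (d + 1)) * (1 / (q : ℝ) * ∏ p ∈ S, e p) := by
        intro d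
        push_cast
        field_simp
      simp_rw [this]
      rw [tsum_mul_right]
      push_cast
      field_simp

noncomputable def auxGA (P : ℝ) : ℝ := 1 - (1 * P + 1) / ((P - 1) ^ 2 * (P + 1))

noncomputable def auxGC (P : ℝ) : ℝ := 1 - (0 * P + 1) / ((P - 1) ^ 2 * (P + 1))

noncomputable def auxGB (P : ℝ) (d : ℕ) : ℝ := (1 - 1 / (P ^ d * (P - 1))) * (1 - 1 / P)⁻¹

noncomputable def auxG (N p : ℕ) : ℝ := Kfactor N p * (if p ∣ N then (1 - 1 / (p : ℝ))⁻¹ else 1)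

noncomputable def auxV (k : ℕ) (P : ℝ) (d : ℕ) : ℝ := if d = 0 then auxGA P ^ k else auxGB P d ^ k

lemma auxG_dvd {N p : ℕ} (h : p ∣ N) : auxG N p = auxGB p (N.factorization p) := by
  simp [auxG, Kfactor, auxGB, h]

lemma aux_int_dvd (N p : ℕ) : (p : ℤ) ∣ ((N : ℤ) - 1) ↔ N ≡ 1 [MOD p] := by
  rw [Nat.ModEq.comm, Nat.modEq_iff_dvd]
  simp

lemma auxG_A {N p : ℕ} (h : ¬ p ∣ N) (h1 : ¬ N ≡ 1 [MOD p]) : auxG N p = auxGA p := by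
  have h2 := h1
  rw [← aux_int_dvd] at h2
  unfold auxG Kfactor auxGA
  rw [if_neg h, if_neg h, if_neg h2, mul_one]

lemma auxG_C {N p : ℕ} (h : ¬ p ∣ N) (h1 : N ≡ 1 [MOD p]) : auxG N p = auxGC p := by
  have h2 := h1
  rw [← aux_int_dvd] at h2
  unfold auxG Kfactor auxGC
  rw [if_neg h, if_neg h, if_pos h2, mul_one]

lemma auxGA_bd {P : ℝ} (hP : 2 ≤ P) : |auxGA P - 1| ≤ 4 / P ^ 2 := by
  have h1 : 0 < P - 1 := by linarith
  have h2 : 0 < P + 1 := by linarith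
  have e : auxGA P - 1 = -(1 / (P - 1) ^ 2) := by
    unfold auxGA; field_simp; ring
  rw [e, abs_neg, abs_of_pos (by positivity), div_le_div_iff₀ (by positivity) (by positivity)]
  nlinarith

lemma auxGC_bd {P : ℝ} (hP : 2 ≤ P) : |auxGC P - 1| ≤ 4 / P ^ 2 := by
  have h1 : 0 < P - 1 := by linarith
  have h2 : 0 < P + 1 := by linarith
  have e : auxGC P - 1 = -(1 / ((P - 1) ^ 2 * (P + 1))) := by
    unfold auxGC; field_simp; ring
  rw [e, abs_neg, abs_of_pos (by positivity), div_le_div_iff₀ (by positivity) (by positivity)]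
  nlinarith [mul_pos (mul_pos h1 h1) h2, mul_pos h1 h1]

lemma auxGB_bd {P : ℝ} (hP : 2 ≤ P) {d : ℕ} (hd : d ≠ 0) : |auxGB P d - 1| ≤ 2 / P := by
  have h1 : 0 < P - 1 := by linarith
  have h0 : 0 < P := by linarith
  have hp : P ≤ P ^ d := le_self_pow₀ (by linarith) hd
  have hpd : 0 < P ^ d := by positivity
  have e : auxGB P d - 1 = 1 / (P - 1) - P / (P ^ d * (P - 1) ^ 2) := by
    have : 1 - 1 / P = (P - 1) / P := by field_simp
    unfold auxGB; rw [this]; field_simp; ring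
  have b1 : 1 / (P - 1) ≤ 2 / P := by
    rw [div_le_div_iff₀ h1 h0]; linarith
  have b2 : P / (P ^ d * (P - 1) ^ 2) ≤ 1 / (P - 1) := by
    rw [div_le_div_iff₀ (by positivity) h1]
    nlinarith [mul_nonneg hpd.le (mul_nonneg h1.le (by linarith : 0 ≤ P - 2)),
      mul_nonneg h1.le (sub_nonneg.2 hp)]
  have b3 : 0 ≤ P / (P ^ d * (P - 1) ^ 2) := by positivity
  have b4 : 0 ≤ 1 / (P - 1) := by positivity
  rw [e, abs_le]
  constructor <;> linarith

lemma aux_pow_bd (k : ℕ) {x : ℝ} (hx : |x - 1| ≤ 1) : |x ^ k - 1| ≤ (k * 2 ^ k) * |x - 1| := by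
  have h := abs_pow_sub_pow_le x 1 k
  rw [one_pow] at h
  have hx2 : |x| ≤ 2 := by
    rw [abs_le] at *
    constructor <;> linarith
  have hm : max |x| |1| ≤ 2 := max_le hx2 (by norm_num)
  have h2 : max |x| |1| ^ (k - 1) ≤ 2 ^ k :=
    (pow_le_pow_left₀ (le_max_of_le_left (abs_nonneg _)) hm _).trans
      (pow_le_pow_right₀ (by norm_num) (Nat.sub_le _ _))
  calc _ ≤ _ := h
    _ ≤ |x - 1| * k * 2 ^ k := by gcongr
    _ = _ := by ring

lemma aux_prime2 (p : Nat.Primes) : (2 : ℝ) ≤ ((p : ℕ) : ℝ) := by exact_mod_cast p.2.two_le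

lemma aux_two_div {P : ℝ} (hP : 2 ≤ P) : 2 / P ≤ 1 := by
  rw [div_le_one (by linarith)]; exact hP

lemma aux_four_div {P : ℝ} (hP : 2 ≤ P) : 4 / P ^ 2 ≤ 1 := by
  rw [div_le_one (by positivity)]; nlinarith

lemma aux_fact_ne {N p : ℕ} (hp : p.Prime) (hN : 0 < N) (h : p ∣ N) : N.factorization p ≠ 0 :=
  (hp.factorization_pos_of_dvd hN.ne' h).ne'

lemma auxG_bd (p : Nat.Primes) {N : ℕ} (hN : 0 < N) :
    |auxG N p - 1| ≤ (2 / ((p : ℕ) : ℝ)) * (if (p : ℕ) ∣ N then 1 else 0) + 4 / ((p : ℕ) : ℝ) ^ 2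
    ∧ |auxG N p - 1| ≤ 1 := by
  have hP := aux_prime2 p
  by_cases h : (p : ℕ) ∣ N
  · rw [auxG_dvd h, if_pos h, mul_one]
    have hb := auxGB_bd hP (aux_fact_ne p.2 hN h)
    have : 0 ≤ 4 / ((p : ℕ) : ℝ) ^ 2 := by positivity
    exact ⟨by linarith, hb.trans (aux_two_div hP)⟩
  · rw [if_neg h, mul_zero, zero_add]
    by_cases h1 : N ≡ 1 [MOD (p : ℕ)]
    · rw [auxG_C h h1]
      exact ⟨auxGC_bd hP, (auxGC_bd hP).trans (aux_four_div hP)⟩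
    · rw [auxG_A h h1]
      exact ⟨auxGA_bd hP, (auxGA_bd hP).trans (aux_four_div hP)⟩

lemma aux_abs_le_two {x : ℝ} (hx : |x - 1| ≤ 1) : |x| ≤ 2 := by
  rw [abs_le] at *
  constructor <;> linarith

lemma auxV_bd (k : ℕ) {P : ℝ} (hP : 2 ≤ P) (d : ℕ) : |auxV k P d| ≤ 2 ^ k := by
  unfold auxV
  split_ifs with h
  · rw [abs_pow]
    exact pow_le_pow_left₀ (abs_nonneg _)
      (aux_abs_le_two ((auxGA_bd hP).trans (aux_four_div hP))) _
  · rw [abs_pow]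
    exact pow_le_pow_left₀ (abs_nonneg _)
      (aux_abs_le_two ((auxGB_bd hP h).trans (aux_two_div hP))) _

lemma aux_rep (k : ℕ) (p : Nat.Primes) (N : ℕ) (hN : 0 < N) :
    HasSum (fun d => (auxV k (p : ℕ) (d + 1) - auxV k (p : ℕ) d) *
        (if (p : ℕ) ^ (d + 1) ∣ N then 1 else 0))
      ((auxG N p ^ k - 1) - (auxV k (p : ℕ) 0 - 1)
        - (auxGC (p : ℕ) ^ k - auxV k (p : ℕ) 0) * (if N ≡ 1 [MOD p] then 1 else 0)) := by
  have hdv : ∀ d, (p : ℕ) ^ (d + 1) ∣ N ↔ d < N.factorization p := by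
    intro d
    rw [p.2.pow_dvd_iff_le_factorization hN.ne', Nat.succ_le_iff]
  have hs : HasSum (fun d => (auxV k (p : ℕ) (d + 1) - auxV k (p : ℕ) d) *
        (if (p : ℕ) ^ (d + 1) ∣ N then 1 else 0))
        (∑ d ∈ Finset.range (N.factorization p), (auxV k (p : ℕ) (d + 1) - auxV k (p : ℕ) d) *
        (if (p : ℕ) ^ (d + 1) ∣ N then 1 else 0)) := by
    refine hasSum_sum_of_ne_finset_zero fun d hd => ?_
    rw [Finset.mem_range] at hd
    rw [if_neg (by rw [hdv]; exact hd), mul_zero]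
  have h2 : (∑ d ∈ Finset.range (N.factorization p), (auxV k (p : ℕ) (d + 1) - auxV k (p : ℕ) d) *
        (if (p : ℕ) ^ (d + 1) ∣ N then 1 else 0))
        = auxV k (p : ℕ) (N.factorization p) - auxV k (p : ℕ) 0 := by
    rw [← Finset.sum_range_sub]
    refine Finset.sum_congr rfl fun d hd => ?_
    rw [if_pos ((hdv d).2 (Finset.mem_range.1 hd)), mul_one]
  rw [h2] at hs
  have e : auxV k (p : ℕ) (N.factorization p) - auxV k (p : ℕ) 0 =
      ((auxG N p ^ k - 1) - (auxV k (p : ℕ) 0 - 1)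
        - (auxGC (p : ℕ) ^ k - auxV k (p : ℕ) 0) * (if N ≡ 1 [MOD p] then 1 else 0)) := by
    by_cases h : (p : ℕ) ∣ N
    · have h1 : ¬ N ≡ 1 [MOD p] := by
        intro h1
        have h3 := (Nat.modEq_zero_iff_dvd.2 h).symm.trans h1
        have h4 := Nat.modEq_zero_iff_dvd.1 h3.symm
        exact p.2.one_lt.ne' (Nat.dvd_one.1 h4)
      rw [if_neg h1, auxG_dvd h]
      have : auxV k (p : ℕ) (N.factorization p) = auxGB (p : ℕ) (N.factorization p) ^ k := by
        unfold auxV; rw [if_neg (aux_fact_ne p.2 hN h)]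
      rw [this]; ring
    · rw [Nat.factorization_eq_zero_of_not_dvd h]
      by_cases h1 : N ≡ 1 [MOD p]
      · rw [if_pos h1, auxG_C h h1]; ring
      · rw [if_neg h1, auxG_A h h1]; simp [auxV]
  rw [e] at hs
  exact hs

lemma aux_PA (k p : ℕ) (hP : (2 : ℝ) ≤ p) : PA k p = (1 - 2 / (p : ℝ)) * auxGA p ^ k := by
  have h0 : (p : ℝ) ≠ 0 := by linarith
  have h1 : (p : ℝ) - 1 ≠ 0 := by linarith
  have h2 : (p : ℝ) + 1 ≠ 0 := by linarith
  have e : auxGA p = (1 - 2 / (p : ℝ)) * ((1 - 1 / (p : ℝ)) ^ 2)⁻¹ := by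
    have : 1 - 1 / (p : ℝ) = (p - 1) / p := by field_simp
    rw [this]
    unfold auxGA
    field_simp
    ring
  unfold PA
  rw [e, zpow_neg, mul_pow, inv_pow, ← pow_mul, pow_succ]
  have : (1 - 1 / (p : ℝ)) ^ (2 * (k : ℤ)) = (1 - 1 / (p : ℝ)) ^ (2 * k) := by
    rw [← zpow_natCast]; push_cast; rfl
  rw [this]
  ring

lemma aux_PB (k p : ℕ) (hP : (2 : ℝ) ≤ p) : PB k p =
    (1 - 1 / (p : ℝ)) * ∑' d : ℕ, auxV k p (d + 1) / (p : ℝ) ^ (d + 1) := by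
  have h0 : (p : ℝ) ≠ 0 := by linarith
  have h1 : (p : ℝ) - 1 ≠ 0 := by linarith
  have h2 : 1 - 1 / (p : ℝ) ≠ 0 := by
    have : 1 - 1 / (p : ℝ) = (p - 1) / p := by field_simp
    rw [this]; positivity
  unfold PB
  rw [zpow_sub₀ h2, zpow_one, zpow_natCast, div_eq_mul_inv, mul_assoc, ← tsum_mul_left]
  congr 2
  funext d
  simp only [auxV, auxGB, Nat.succ_ne_zero, if_false, mul_pow, inv_pow]
  ring

lemma aux_PC (k p : ℕ) : PC k p = (1 / (p : ℝ)) * auxGC p ^ k := by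
  simp [PC, auxGC]

lemma aux_e (k : ℕ) (p : Nat.Primes) : PA k p + PB k p + PC k p - 1 =
    (auxV k (p : ℕ) 0 - 1) + (auxGC (p : ℕ) ^ k - auxV k (p : ℕ) 0) / (p : ℕ)
      + ∑' d, (auxV k (p : ℕ) (d + 1) - auxV k (p : ℕ) d) / ((p : ℕ) : ℝ) ^ (d + 1) := by
  have hP := aux_prime2 p
  set P : ℝ := ((p : ℕ) : ℝ) with hPd
  have h0 : 0 < P := by linarith
  rw [aux_PA k p hP, aux_PB k p hP, aux_PC, ← hPd]
  have hs : Summable fun d => auxV k P d / P ^ d := by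
    refine Summable.of_norm_bounded (g := fun d => 2 ^ k * (1 / P) ^ d) ?_ ?_
    · refine Summable.mul_left _ (summable_geometric_of_lt_one (by positivity) ?_)
      rw [div_lt_one h0]; linarith
    · intro d
      rw [norm_div, Real.norm_eq_abs, Real.norm_eq_abs, abs_of_pos (pow_pos h0 d), div_pow, one_pow,
        mul_one_div]
      exact div_le_div_of_nonneg_right (auxV_bd k hP d) (by positivity)
  have hs1 := (summable_nat_add_iff 1).2 hs
  have hz := hs.tsum_eq_zero_add
  have hsub : ∑' d, (auxV k P (d + 1) - auxV k P d) / P ^ (d + 1)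
      = ∑' d, auxV k P (d + 1) / P ^ (d + 1) - (1 / P) * ∑' d, auxV k P d / P ^ d := by
    rw [← tsum_mul_left, ← hs1.tsum_sub (hs.mul_left _)]
    congr 1
    funext d
    rw [pow_succ]
    field_simp
  rw [hsub, hz]
  have : auxV k P 0 = auxGA P ^ k := by simp [auxV]
  rw [this, pow_zero]
  generalize (∑' d : ℕ, auxV k P (d + 1) / P ^ (d + 1)) = T
  field_simp
  ring

lemma aux_sum_sq : Summable fun p : Nat.Primes => 1 / ((p : ℕ) : ℝ) ^ 2 := by
  have h : Summable fun n : ℕ => 1 / (n : ℝ) ^ 2 := Real.summable_one_div_nat_pow.2 one_lt_two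
  exact h.comp_injective (Subtype.val_injective)

lemma aux_sum_dvd {N : ℕ} (hN : 0 < N) (f : Nat.Primes → ℝ) :
    Summable fun p : Nat.Primes => f p * (if (p : ℕ) ∣ N then 1 else 0) := by
  refine summable_of_hasFiniteSupport ?_
  have : Set.Finite ((fun p : Nat.Primes => (p : ℕ)) ⁻¹' (Set.Iic N)) :=
    (Set.finite_Iic N).preimage Subtype.val_injective.injOn
  refine this.subset fun p hp => ?_
  by_contra h
  apply hp
  have : ¬ (p : ℕ) ∣ N := fun hd => h (Nat.le_of_dvd hN hd)
  simp [this]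

lemma aux_Kstar {N : ℕ} (hN : 0 < N) : HasProd (fun p : Nat.Primes => auxG N p) (Kstar N) := by
  set f : Nat.Primes → ℝ := fun p => if (p : ℕ) ∣ N then (1 - 1 / ((p : ℕ) : ℝ))⁻¹ else 1 with hf
  have hfne : ∀ p : Nat.Primes, (1 - 1 / ((p : ℕ) : ℝ)) ≠ 0 := by
    intro p
    have hP := aux_prime2 p
    have : 1 / ((p : ℕ) : ℝ) ≤ 1 / 2 := one_div_le_one_div_of_le (by norm_num) hP
    linarith
  -- product of f
  have h1 : HasProd f ((N : ℝ) / (Nat.totient N : ℝ)) := by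
    set S : Finset Nat.Primes := N.primeFactors.subtype Nat.Prime with hS
    have : HasProd f (∏ p ∈ S, f p) := hasProd_prod_of_ne_finset_one (by
      intro p hp
      have : ¬ (p : ℕ) ∣ N := by
        intro hd
        exact hp (Finset.mem_subtype.2 (Nat.mem_primeFactors.2 ⟨p.2, hd, hN.ne'⟩))
      simp [hf, this])
    convert this using 1
    have e1 : ∏ p ∈ S, f p = ∏ p ∈ N.primeFactors, (1 - ((p : ℕ) : ℝ)⁻¹)⁻¹ := by
      rw [← Finset.prod_subtype_of_mem (p := Nat.Prime) (s := N.primeFactors)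
        (fun p => (1 - ((p : ℕ) : ℝ)⁻¹)⁻¹) (fun p hp => Nat.prime_of_mem_primeFactors hp)]
      refine Finset.prod_congr rfl fun p hp => ?_
      have : (p : ℕ) ∣ N := Nat.dvd_of_mem_primeFactors (Finset.mem_subtype.1 hp)
      simp [hf, this]
    have e2 := Nat.totient_eq_mul_prod_factors N
    have e3 : (Nat.totient N : ℝ) = N * ∏ p ∈ N.primeFactors, (1 - ((p : ℕ) : ℝ)⁻¹) := by
      have := congrArg (fun q : ℚ => (q : ℝ)) e2
      push_cast at this
      exact this
    have hN' : (N : ℝ) ≠ 0 := by exact_mod_cast hN.ne'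
    rw [e1, e3, Finset.prod_inv_distrib]
    rw [div_mul_eq_div_div, div_self hN', one_div]
  -- product of Kfactor
  have hfinv : ∀ p : Nat.Primes, Kfactor N p = auxG N p * (f p)⁻¹ := by
    intro p
    have : f p ≠ 0 := by
      simp only [hf]
      split_ifs
      · exact inv_ne_zero (hfne p)
      · exact one_ne_zero
    rw [auxG, mul_assoc, mul_inv_cancel₀ this, mul_one]
  have hG : Multipliable fun p : Nat.Primes => auxG N p := by
    have hsum : Summable fun p : Nat.Primes => ‖auxG N p - 1‖ := by
      refine Summable.of_nonneg_of_le (fun _ => norm_nonneg _) (fun p => (auxG_bd p hN).1) ?_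
      refine (aux_sum_dvd hN _).add ?_
      simpa [div_eq_mul_inv] using aux_sum_sq.mul_left 4
    have := multipliable_one_add_of_summable hsum
    simpa using this
  have hfi : Multipliable fun p : Nat.Primes => (f p)⁻¹ := by
    have hsum : Summable fun p : Nat.Primes => ‖(f p)⁻¹ - 1‖ := by
      refine (aux_sum_dvd hN (fun p => ‖(f p)⁻¹ - 1‖)).congr fun p => ?_
      by_cases h : (p : ℕ) ∣ N <;> simp [hf, h]
    have := multipliable_one_add_of_summable hsum
    simpa using this
  have hK : HasProd (fun p : Nat.Primes => Kfactor N p) (K N) := by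
    have : Multipliable (fun p : Nat.Primes => Kfactor N p) := by
      simp_rw [hfinv]
      exact hG.mul hfi
    exact this.hasProd
  have := hK.mul h1
  rw [Kstar, mul_div_assoc]
  exact this

theorem stmt_13 (k : ℕ) :
    Multipliable (fun ℓ : Nat.Primes => PA k ℓ + PB k ℓ + PC k ℓ) ∧
    Filter.Tendsto
      (fun x : ℝ => (1/x) * ∑ N ∈ Finset.Icc 1 ⌊x⌋₊, (Kstar N)^k)
      Filter.atTop
      (nhds (∏' ℓ : Nat.Primes, (PA k ℓ + PB k ℓ + PC k ℓ))) := by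
  set a : Nat.Primes → ℕ → ℝ := fun p N => auxG N p ^ k - 1 with ha
  set e : Nat.Primes → ℝ := fun p => PA k p + PB k p + PC k p - 1 with he
  set C : ℝ := k * 2 ^ k with hC
  have hC0 : 0 ≤ C := by positivity
  set u : Nat.Primes → ℝ := fun p => C * (2 / ((p : ℕ) : ℝ)) with hu
  set v : Nat.Primes → ℝ := fun p => C * (4 / ((p : ℕ) : ℝ) ^ 2) with hv
  set w : Nat.Primes → ℝ := fun p => u p / (p : ℕ) + v p with hw
  have hu0 : ∀ p, 0 ≤ u p := fun p => by simp only [hu]; positivity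
  have hv0 : ∀ p, 0 ≤ v p := fun p => by simp only [hv]; positivity
  have hw0 : ∀ p, 0 ≤ w p := fun p => by
    have := hu0 p
    have := hv0 p
    simp only [hw]; positivity
  have hvs : Summable v := by
    refine (aux_sum_sq.mul_left (C * 4)).congr fun p => ?_
    simp only [hv]; ring
  have hws : Summable w := by
    refine (aux_sum_sq.mul_left (C * 6)).congr fun p => ?_
    have hP := aux_prime2 p
    simp only [hw, hv, hu]; field_simp; ring
  have hwS : Summable fun S : Finset Nat.Primes => ∏ p ∈ S, w p :=
    summable_finsetProd_of_summable_nonneg hw0 hws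
  have habd : ∀ p : Nat.Primes, ∀ N, 0 < N →
      |a p N| ≤ u p * (if (p : ℕ) ∣ N then 1 else 0) + v p := by
    intro p N hN
    obtain ⟨b1, b2⟩ := auxG_bd p hN
    refine (aux_pow_bd k b2).trans ((mul_le_mul_of_nonneg_left b1 hC0).trans_eq ?_)
    simp only [hu, hv]; ring
  have hab1 : ∀ p : Nat.Primes, ∃ B, ∀ N, 0 < N → |a p N| ≤ B := by
    intro p
    refine ⟨u p + v p, fun N hN => (habd p N hN).trans ?_⟩
    have := hu0 p
    split_ifs <;> simp [this]
  have hmean := aux_mean a (fun p => auxV k (p : ℕ) 0 - 1)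
    (fun p => auxGC (p : ℕ) ^ k - auxV k (p : ℕ) 0) e
    (fun p d => auxV k (p : ℕ) (d + 1) - auxV k (p : ℕ) d)
    (fun p N hN => aux_rep k p N hN)
    (fun p => ⟨2 ^ k + 2 ^ k, fun d => (abs_sub _ _).trans
      (add_le_add (auxV_bd k (aux_prime2 p) _) (auxV_bd k (aux_prime2 p) _))⟩)
    hab1 (fun p => aux_e k p)
  have hM : ∀ S : Finset Nat.Primes, Filter.Tendsto
      (fun n : ℕ => (1 / (n : ℝ)) * ∑ N ∈ Finset.Ioc 0 n, ∏ p ∈ S, a p N) Filter.atTop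
      (nhds (∏ p ∈ S, e p)) := by
    intro S
    have := hmean S 1 0 one_pos (fun p _ => Nat.coprime_one_right _)
    simpa [Nat.modEq_one] using this
  have hMb : ∀ (S : Finset Nat.Primes) (n : ℕ), 0 < n →
      ‖(1 / (n : ℝ)) * ∑ N ∈ Finset.Ioc 0 n, ∏ p ∈ S, a p N‖ ≤ ∏ p ∈ S, w p := by
    intro S n hn
    have hn' : (0 : ℝ) < n := by exact_mod_cast hn
    have h1 := aux_upper u v hu0 hv0 n S 1 one_pos (fun p _ => Nat.coprime_one_right _)
    simp only [one_dvd, if_true, Nat.cast_one, div_one] at h1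
    have h2 : |∑ N ∈ Finset.Ioc 0 n, ∏ p ∈ S, a p N| ≤ n * ∏ p ∈ S, w p := by
      refine (Finset.abs_sum_le_sum_abs _ _).trans (le_trans ?_ h1)
      refine Finset.sum_le_sum fun N hN => ?_
      rw [Finset.abs_prod]
      exact Finset.prod_le_prod (fun _ _ => abs_nonneg _)
        fun p _ => habd p N (Finset.mem_Ioc.1 hN).1
    rw [norm_mul, Real.norm_eq_abs, Real.norm_eq_abs, abs_of_pos (by positivity : 1 / (n : ℝ) > 0)]
    calc _ ≤ 1 / (n : ℝ) * (n * ∏ p ∈ S, w p) := by gcongr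
      _ = _ := by field_simp
  have heS : Summable fun S : Finset Nat.Primes => ∏ p ∈ S, e p := by
    refine Summable.of_norm_bounded hwS fun S => ?_
    refine le_of_tendsto (hM S).norm ?_
    filter_upwards [Filter.eventually_gt_atTop 0] with n hn
    exact hMb S n hn
  have hone : ∀ p : Nat.Primes, PA k p + PB k p + PC k p = 1 + e p := by
    intro p; simp only [he]; ring
  simp_rw [hone]
  refine ⟨multipliable_one_add_of_summable_prod heS, ?_⟩
  rw [tprod_one_add heS]
  have hT : Filter.Tendsto (fun n : ℕ => ∑' S : Finset Nat.Primes,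
      (1 / (n : ℝ)) * ∑ N ∈ Finset.Ioc 0 n, ∏ p ∈ S, a p N) Filter.atTop
      (nhds (∑' S : Finset Nat.Primes, ∏ p ∈ S, e p)) := by
    refine tendsto_tsum_of_dominated_convergence hwS hM ?_
    filter_upwards [Filter.eventually_gt_atTop 0] with n hn S
    exact hMb S n hn
  have hKs : ∀ N, 0 < N → HasSum (fun S : Finset Nat.Primes => ∏ p ∈ S, a p N) (Kstar N ^ k) := by
    intro N hN
    have hsum : Summable fun p => ‖a p N‖ :=
      Summable.of_nonneg_of_le (fun _ => norm_nonneg _) (fun p => habd p N hN)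
        ((aux_sum_dvd hN _).add hvs)
    have hS : Summable fun S : Finset Nat.Primes => ∏ p ∈ S, a p N :=
      summable_finsetProd_of_summable_norm hsum
    have h1 := hasProd_one_add_of_hasSum_prod hS.hasSum
    have h2 := (aux_Kstar hN).pow k
    have h3 : (fun p : Nat.Primes => 1 + a p N) = fun p : Nat.Primes => auxG N p ^ k := by
      funext p; simp only [ha]; ring
    rw [h3] at h1
    rw [h2.unique h1]
    exact hS.hasSum
  have hT2 : Filter.Tendsto (fun n : ℕ => (1 / (n : ℝ)) * ∑ N ∈ Finset.Icc 1 n, Kstar N ^ k)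
      Filter.atTop (nhds (∑' S : Finset Nat.Primes, ∏ p ∈ S, e p)) := by
    refine hT.congr fun n => ?_
    have := (hasSum_sum (s := Finset.Ioc 0 n) fun N hN =>
      hKs N (Finset.mem_Ioc.1 hN).1).mul_left (1 / (n : ℝ))
    rw [this.tsum_eq]
    rfl
  have hfl : Filter.Tendsto (fun x : ℝ => ⌊x⌋₊) Filter.atTop Filter.atTop := tendsto_nat_floor_atTop
  have hT3 := (tendsto_nat_floor_div_atTop (R := ℝ)).mul (hT2.comp hfl)
  rw [one_mul] at hT3
  refine hT3.congr' ?_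
  filter_upwards [Filter.eventually_ge_atTop 1] with x hx
  have : ((⌊x⌋₊ : ℕ) : ℝ) ≠ 0 := by
    have := (Nat.one_le_floor_iff x).2 hx
    positivity
  have hx0 : x ≠ 0 := by linarith
  simp only [Function.comp]
  field_simp
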